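/- arXiv:2012.11252 — 2 statements merged into one kernel-verified Lean document; each statement's English description precedes it below -/
import Mathlib

section
/- Let φ^λ(z) := exp(−λ(1−z)/(1+z)) for λ ≥ 0, the λ-th power of the atomic singular inner function. Then the closed linear span in H^2(𝔻) of {φ^λ : 0 ≤ λ < ∞} is all of H^2(𝔻). -/
open Complex MeasureTheory Metric Set

/-- Taylor coefficient at 0. -/
noncomputable def hcoeff (f : ℂ → ℂ) (n : ℕ) : ℂ := iteratedDeriv n f 0 / n.factorial

/-- H² inner product via Taylor coefficients (conjugate-linear in first slot). -/
noncomputable def hinner (f g : ℂ → ℂ) : ℂ :=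
  ∑' n : ℕ, (starRingEnd ℂ) (hcoeff f n) * hcoeff g n

/-- H² squared norm via Taylor coefficients. -/
noncomputable def hnormSq (f : ℂ → ℂ) : ℝ := ∑' n : ℕ, ‖hcoeff f n‖ ^ 2

/-- Membership in the Hardy space H²(𝔻). -/
def MemH2 (f : ℂ → ℂ) : Prop :=
  DifferentiableOn ℂ f (ball 0 1) ∧ Summable fun n : ℕ => ‖hcoeff f n‖ ^ 2

/-- Inner function on the unit disc. -/
def IsInner (u : ℂ → ℂ) : Prop :=
  DifferentiableOn ℂ u (ball 0 1) ∧ (∀ z ∈ ball (0 : ℂ) 1, ‖u z‖ ≤ 1) ∧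
    ∀ᵐ t : ℝ, Filter.Tendsto (fun r : ℝ => ‖u ((r : ℂ) * Complex.exp (Complex.I * t))‖)
      (nhdsWithin 1 (Set.Iio 1)) (nhds 1)

/-- Membership in the model space K_u = H² ⊖ uH². -/
def MemK (u f : ℂ → ℂ) : Prop :=
  MemH2 f ∧ ∀ g, MemH2 g → hinner (fun z => u z * g z) f = 0

/-- The powers of the atomic singular inner function. -/
noncomputable def phi (lam : ℝ) (z : ℂ) : ℂ := Complex.exp (-(lam : ℂ) * (1 - z) / (1 + z))

/-- Membership in the closed linear span of a family {F λ : λ ∈ A} in H². -/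
def InClosedSpan (F : ℝ → ℂ → ℂ) (A : Set ℝ) (f : ℂ → ℂ) : Prop :=
  MemH2 f ∧ ∀ ε > 0, ∃ (n : ℕ) (c : Fin n → ℂ) (lam : Fin n → ℝ),
    (∀ i, lam i ∈ A) ∧ hnormSq (fun z => f z - ∑ i, c i * F (lam i) z) < ε


theorem den_ne {z : ℂ} (hz : z ∈ ball (0:ℂ) 1) : 1 + z ≠ 0 := by
  intro h
  have : z = -1 := by linear_combination h
  subst this
  simp at hz

theorem phi_hasDeriv (lam : ℝ) {z : ℂ} (hz : z ∈ ball (0:ℂ) 1) :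
    HasDerivAt (phi lam) (2 * lam / (1+z)^2 * phi lam z) z := by
  have h := den_ne hz
  have h1 : HasDerivAt (fun z : ℂ => -(lam:ℂ) * (1 - z) / (1+z)) (2 * lam / (1+z)^2) z := by
    have a : HasDerivAt (fun z : ℂ => -(lam:ℂ) * (1 - z)) (-(lam:ℂ) * (-1)) z :=
      ((hasDerivAt_id z).const_sub 1).const_mul _
    have b : HasDerivAt (fun z : ℂ => 1 + z) 1 z := (hasDerivAt_id z).const_add 1
    refine (a.div b h).congr_deriv ?_
    field_simp
    ring
  refine h1.cexp.congr_deriv ?_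
  unfold phi
  ring

theorem phi_diff (lam : ℝ) : DifferentiableOn ℂ (phi lam) (ball 0 1) :=
  fun _ hz => (phi_hasDeriv lam hz).differentiableAt.differentiableWithinAt

theorem phi_norm_le {lam : ℝ} (hl : 0 ≤ lam) {z : ℂ} (hz : z ∈ ball (0:ℂ) 1) :
    ‖phi lam z‖ ≤ 1 := by
  have h := den_ne hz
  unfold phi
  rw [Complex.norm_exp, Real.exp_le_one_iff]
  have hz' : Complex.normSq z < 1 := by
    rw [mem_ball_zero_iff] at hz
    rw [Complex.normSq_eq_norm_sq]
    nlinarith [norm_nonneg z]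
  have : (-(lam:ℂ) * (1 - z) / (1+z)).re = -(lam * ((1 - normSq z) / normSq (1+z))) := by
    have hn : normSq (1+z) ≠ 0 := by simpa using h
    rw [Complex.div_re]
    field_simp
    simp [Complex.normSq_apply]
    ring
  rw [this]
  have : 0 ≤ (1 - normSq z) / normSq (1+z) := div_nonneg (by linarith) (normSq_nonneg _)
  nlinarith [mul_nonneg hl this]

theorem hc_hasSum {f : ℂ → ℂ} (hf : DifferentiableOn ℂ f (ball 0 1)) {z : ℂ}
    (hz : z ∈ ball (0:ℂ) 1) : HasSum (fun n => hcoeff f n * z^n) (f z) := by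
  have := Complex.hasSum_taylorSeries_on_ball hf hz
  have e : (fun n => hcoeff f n * z^n) =
      (fun n : ℕ ↦ (n.factorial : ℂ)⁻¹ • (z - 0) ^ n • iteratedDeriv n f 0) := by
    funext n
    simp only [hcoeff, div_eq_inv_mul, sub_zero, smul_eq_mul]
    ring
  rw [e]
  exact this

theorem hc_contDiff {f : ℂ → ℂ} (hf : DifferentiableOn ℂ f (ball 0 1)) (n : WithTop ℕ∞) :
    ContDiffAt ℂ n f 0 :=
  (hf.analyticAt (ball_mem_nhds 0 one_pos)).contDiffAt

theorem hc_deriv (f : ℂ → ℂ) (n : ℕ) : hcoeff (deriv f) n = (n+1) * hcoeff f (n+1) := by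
  unfold hcoeff
  rw [iteratedDeriv_succ', Nat.factorial_succ]
  push_cast
  have : (n:ℂ) + 1 ≠ 0 := by exact_mod_cast n.succ_ne_zero
  field_simp

theorem hc_X (f : ℂ → ℂ) (hf : DifferentiableOn ℂ f (ball 0 1)) (n : ℕ) :
    hcoeff (fun z => z * f z) (n+1) = hcoeff f n := by
  unfold hcoeff
  have : (fun z => z * f z) = (fun z => z) * f := rfl
  rw [this, iteratedDeriv_mul (by fun_prop) (hc_contDiff hf _)]
  rw [Finset.sum_eq_single 1]
  · simp [Nat.factorial_succ]
    have : (n:ℂ) + 1 ≠ 0 := by exact_mod_cast n.succ_ne_zero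
    field_simp
  · intro b hb hb1
    rcases b with _ | _ | b
    · simp
    · simp at hb1
    · simp [iteratedDeriv_succ']
  · simp

theorem hc_X0 (f : ℂ → ℂ) : hcoeff (fun z => z * f z) 0 = 0 := by
  simp [hcoeff]

theorem hc_add {f g : ℂ → ℂ} (hf : DifferentiableOn ℂ f (ball 0 1))
    (hg : DifferentiableOn ℂ g (ball 0 1)) (n : ℕ) :
    hcoeff (fun z => f z + g z) n = hcoeff f n + hcoeff g n := by
  unfold hcoeff
  rw [iteratedDeriv_fun_add (hc_contDiff hf _) (hc_contDiff hg _)]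
  ring

theorem hc_smul (c : ℂ) (f : ℂ → ℂ) (n : ℕ) :
    hcoeff (fun z => c * f z) n = c * hcoeff f n := by
  unfold hcoeff
  rw [iteratedDeriv_const_mul_field]
  ring

theorem hc_lin {f : ℂ → ℂ} (hf : DifferentiableOn ℂ f (ball 0 1)) {m : ℕ} (c : Fin m → ℂ)
    (lam : Fin m → ℝ) (n : ℕ) :
    hcoeff (fun z => f z - ∑ i, c i * phi (lam i) z) n
      = hcoeff f n - ∑ i, c i * hcoeff (phi (lam i)) n := by
  have hd : ∀ i, DifferentiableOn ℂ (fun z => c i * phi (lam i) z) (ball 0 1) :=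
    fun i => (phi_diff _).const_mul _
  simp_rw [← hc_smul]
  unfold hcoeff
  have h2 : ContDiffAt ℂ n (fun z => ∑ i, c i * phi (lam i) z) 0 :=
    ContDiffAt.sum fun i _ => hc_contDiff (hd i) _
  rw [iteratedDeriv_fun_sub (hc_contDiff hf _) h2,
    iteratedDeriv_fun_sum (fun i _ => hc_contDiff (hd i) _), sub_div, Finset.sum_div]

/-- coefficient recurrence -/
theorem phi_rec (lam : ℝ) : hcoeff (phi lam) 0 = Complex.exp (-lam) ∧
    hcoeff (phi lam) 1 = 2 * lam * hcoeff (phi lam) 0 ∧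
    ∀ n : ℕ, ((n:ℂ)+2) * hcoeff (phi lam) (n+2) + 2 * (n+1) * hcoeff (phi lam) (n+1)
      + n * hcoeff (phi lam) n = 2 * lam * hcoeff (phi lam) (n+1) := by
  set G := deriv (phi lam) with hG
  have hGd : DifferentiableOn ℂ G (ball 0 1) := (phi_diff lam).deriv isOpen_ball
  have hzG : DifferentiableOn ℂ (fun z => z * G z) (ball 0 1) := by fun_prop
  have hzzG : DifferentiableOn ℂ (fun z => z * (z * G z)) (ball 0 1) := by fun_prop
  have key : ∀ n, hcoeff (fun z => 2 * lam * phi lam z) n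
      = hcoeff G n + (2 * hcoeff (fun z => z * G z) n + hcoeff (fun z => z * (z * G z)) n) := by
    intro n
    rw [← hc_smul 2, ← hc_add (hzG.const_mul _) hzzG, ← hc_add hGd ((hzG.const_mul _).fun_add hzzG)]
    unfold hcoeff
    congr 1
    apply Filter.EventuallyEq.iteratedDeriv_eq
    filter_upwards [ball_mem_nhds (0:ℂ) one_pos] with z hz
    rw [hG, (phi_hasDeriv lam hz).deriv]
    have := den_ne hz
    field_simp
    ring
  simp only [hc_smul] at key
  refine ⟨by simp [hcoeff, phi], ?_, fun n => ?_⟩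
  · have := key 0
    rw [hc_X0, hc_X0, hc_deriv] at this
    simp at this
    rw [this]
  · have := key (n+1)
    rw [hc_X _ hGd, hc_X _ hzG, hG, hc_deriv, hc_deriv] at this
    rw [this]
    rcases n with _ | n
    · rw [hc_X0]; push_cast; ring
    · rw [hc_X _ hGd, hc_deriv]; push_cast; ring

theorem hc_bound {f : ℂ → ℂ} (hf : DifferentiableOn ℂ f (ball 0 1))
    (hb : ∀ z ∈ ball (0:ℂ) 1, ‖f z‖ ≤ 1) (N : ℕ) :
    ∑ n ∈ Finset.range N, ‖hcoeff f n‖^2 ≤ 1 := by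
  have step : ∀ r : ℝ, 0 < r → r < 1 →
      ∑ n ∈ Finset.range N, ‖hcoeff f n‖^2 * (r^n)^2 ≤ 1 := by
    intro r hr hr1
    have hrb : (r:ℂ) ∈ ball (0:ℂ) 1 := by
      simp [abs_of_pos hr, hr1]
    have hs : Summable (fun n => ‖hcoeff f n‖ * r^n) := by
      have := (hc_hasSum hf hrb).summable.norm
      simpa [abs_of_pos hr] using this
    have hlim : Filter.Tendsto (fun M => ∑' n, ‖hcoeff f (n+M)‖ * r^(n+M))
        Filter.atTop (nhds 0) :=
      tendsto_sum_nat_add (fun n => ‖hcoeff f n‖ * r^n)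
    have hlim2 : Filter.Tendsto (fun M => (1 + ∑' n, ‖hcoeff f (n+M)‖ * r^(n+M))^2)
        Filter.atTop (nhds 1) := by
      simpa using (hlim.const_add 1).pow 2
    refine ge_of_tendsto hlim2 ?_
    filter_upwards [Filter.eventually_ge_atTop N] with M hM
    set p : Polynomial ℂ := ∑ n ∈ Finset.range M, Polynomial.monomial n (hcoeff f n * r^n) with hp
    have hcoef : ∀ n, p.coeff n = if n < M then hcoeff f n * r^n else 0 := by
      intro n
      simp [hp, Polynomial.coeff_monomial]
    have h1 : ∑ n ∈ Finset.range N, ‖hcoeff f n‖^2 * (r^n)^2 ≤ ∑ i ∈ p.support, ‖p.coeff i‖^2 := by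
      calc ∑ n ∈ Finset.range N, ‖hcoeff f n‖^2 * (r^n)^2
          = ∑ n ∈ Finset.range N, ‖p.coeff n‖^2 := by
            refine Finset.sum_congr rfl fun n hn => ?_
            rw [Finset.mem_range] at hn
            rw [hcoef, if_pos (by omega)]
            simp [abs_of_pos hr, mul_pow]
        _ ≤ ∑ n ∈ Finset.range N ∪ p.support, ‖p.coeff n‖^2 :=
            Finset.sum_le_sum_of_subset_of_nonneg Finset.subset_union_left
              (fun _ _ _ => by positivity)
        _ = ∑ i ∈ p.support, ‖p.coeff i‖^2 := by
            symm
            refine Finset.sum_subset Finset.subset_union_right fun n _ hn => ?_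
            rw [Polynomial.notMem_support_iff] at hn
            simp [hn]
    refine h1.trans ?_
    rw [Polynomial.sum_sq_norm_coeff_eq_circleAverage]
    refine Real.circleAverage_mono_on_of_le_circle ?_ ?_
    · apply ContinuousOn.circleIntegrable'
      fun_prop
    · intro w hw
      have hw1 : ‖w‖ = 1 := by simpa using hw
      have hz : (r:ℂ) * w ∈ ball (0:ℂ) 1 := by
        simp [hw1, abs_of_pos hr, hr1]
      have hsum := hc_hasSum hf hz
      have hev : p.eval w = ∑ n ∈ Finset.range M, hcoeff f n * (r * w)^n := by
        simp only [hp, Polynomial.eval_finsetSum, Polynomial.eval_monomial, mul_pow]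
        exact Finset.sum_congr rfl fun n _ => by ring
      have hsplit := hsum.summable.sum_add_tsum_nat_add M
      rw [hsum.tsum_eq, ← hev] at hsplit
      have htail : ‖∑' n, hcoeff f (n+M) * (r*w)^(n+M)‖ ≤ ∑' n, ‖hcoeff f (n+M)‖ * r^(n+M) := by
        refine tsum_of_norm_bounded ((summable_nat_add_iff M).2 hs).hasSum fun n => ?_
        simp [hw1, abs_of_pos hr]
      have he : p.eval w = f (r*w) - ∑' n, hcoeff f (n+M) * (r*w)^(n+M) := by
        rw [← hsplit]; ring
      gcongr
      rw [he]
      exact (norm_sub_le _ _).trans (add_le_add (hb _ hz) htail)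
  have hl : Filter.Tendsto (fun r : ℝ => ∑ n ∈ Finset.range N, ‖hcoeff f n‖^2 * (r^n)^2)
      (nhdsWithin 1 (Set.Iio 1)) (nhds (∑ n ∈ Finset.range N, ‖hcoeff f n‖^2)) := by
    have : Continuous (fun r : ℝ => ∑ n ∈ Finset.range N, ‖hcoeff f n‖^2 * (r^n)^2) := by
      fun_prop
    have h := this.tendsto 1
    simp only [one_pow, mul_one] at h
    exact h.mono_left nhdsWithin_le_nhds
  refine le_of_tendsto hl ?_
  filter_upwards [Ioo_mem_nhdsLT (zero_lt_one' ℝ)] with r hr using step r hr.1 hr.2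

theorem phi_mem {lam : ℝ} (hl : 0 ≤ lam) : MemH2 (phi lam) :=
  ⟨phi_diff lam, summable_of_sum_range_le (fun _ => by positivity)
    (hc_bound (phi_diff lam) fun _ hz => phi_norm_le hl hz)⟩

theorem gam_int (k : ℕ) {r : ℝ} (hr : 0 < r) :
    IntegrableOn (fun t : ℝ => t^k * Real.exp (-(r*t))) (Ioi 0) ∧
    ∫ t in Ioi (0:ℝ), t^k * Real.exp (-(r*t)) = k.factorial / r^(k+1) := by
  have h := Real.integral_rpow_mul_exp_neg_mul_Ioi (a := k+1) (by positivity) hr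
  have e : (fun t : ℝ => t ^ ((k:ℝ)+1-1) * Real.exp (-(r*t))) =
      fun t : ℝ => t^k * Real.exp (-(r*t)) := by
    funext t; simp
  rw [e] at h
  have h' : ∫ t in Ioi (0:ℝ), t^k * Real.exp (-(r*t)) = k.factorial / r^(k+1) := by
    rw [h, Real.Gamma_nat_eq_factorial]
    have : (1 / r) ^ ((k:ℝ)+1) = (1/r)^(k+1) := by exact_mod_cast Real.rpow_natCast (1/r) (k+1)
    rw [this, one_div, inv_pow]; field_simp
  exact ⟨.of_integral_ne_zero (by rw [h']; positivity), h'⟩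

theorem choose_rec (k n : ℕ) : (n+2) * (k+1).choose (n+2) + 2*(n+1) * (k+1).choose (n+1)
    + n * (k+1).choose n = (k+1) * (k+2).choose (n+1) := by
  have a1 := Nat.add_one_mul_choose_eq k (n+1)
  have a2 := Nat.add_one_mul_choose_eq k n
  have c : n * (k+1).choose n = (k+1) * (k.choose n) - 0 - (k+1)*(k.choose n) + n * (k+1).choose n := by omega
  have a3 : (k+1) * (k+2).choose (n+1) = (k+1) * ((k+1).choose n + (k+1).choose (n+1)) := rfl
  rw [a3]
  have a4 : (k+1) * (k+1).choose (n+1) = (k+1) * (k.choose n + k.choose (n+1)) := rfl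
  have a5 : (n+1) * (k+1).choose (n+1) + n * (k+1).choose n = (k+1) * (k+1).choose n := by
    have := Nat.choose_succ_right_eq (k+1) n
    rcases le_or_gt n (k+1) with h | h
    · obtain ⟨d, hd⟩ := Nat.exists_eq_add_of_le h
      have : (k+1).choose (n+1) * (n+1) = (k+1).choose n * d := by
        rw [this]; congr 1; omega
      rw [mul_comm (n+1), this, mul_comm n, ← mul_add, mul_comm (k+1)]
      congr 1; omega
    · simp [Nat.choose_eq_zero_of_lt h, Nat.choose_eq_zero_of_lt (Nat.lt_succ_of_lt h)]
  linarith

theorem moments (n : ℕ) : ∀ k : ℕ,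
    IntegrableOn (fun t : ℝ => (t:ℂ)^k * Complex.exp (-t) * hcoeff (phi t) n) (Ioi 0) ∧
    ∫ t in Ioi (0:ℝ), (t:ℂ)^k * Complex.exp (-t) * hcoeff (phi t) n
      = k.factorial / 2^(k+1) * (k+1).choose n := by
  induction n using Nat.strong_induction_on with
  | _ n ih =>
  intro k
  rcases n with _ | _ | n
  · obtain ⟨h1, h2⟩ := gam_int k two_pos
    have e : (fun t : ℝ => (t:ℂ)^k * Complex.exp (-t) * hcoeff (phi t) 0) =
        fun t : ℝ => ((t^k * Real.exp (-(2*t)) : ℝ) : ℂ) := by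
      funext t
      rw [(phi_rec t).1]
      push_cast
      rw [mul_assoc, ← Complex.exp_add]
      ring_nf
    rw [e]
    refine ⟨h1.ofReal, ?_⟩
    rw [integral_complex_ofReal, h2]
    simp
  · obtain ⟨h1, h2⟩ := ih 0 (by omega) (k+1)
    have e : (fun t : ℝ => (t:ℂ)^k * Complex.exp (-t) * hcoeff (phi t) (0+1)) =
        fun t : ℝ => 2 * ((t:ℂ)^(k+1) * Complex.exp (-t) * hcoeff (phi t) 0) := by
      funext t
      rw [zero_add, (phi_rec t).2.1]
      ring
    rw [e]
    refine ⟨h1.const_mul 2, ?_⟩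
    rw [integral_const_mul, h2]
    simp [Nat.factorial_succ]
    field_simp
    ring
  · obtain ⟨h1, h2⟩ := ih (n+1) (by omega) (k+1)
    obtain ⟨h3, h4⟩ := ih (n+1) (by omega) k
    obtain ⟨h5, h6⟩ := ih n (by omega) k
    have hn : (n:ℂ) + 2 ≠ 0 := by exact_mod_cast (n+1).succ_ne_zero
    have e : (fun t : ℝ => (t:ℂ)^k * Complex.exp (-t) * hcoeff (phi t) (n+1+1)) =
        fun t : ℝ => (2/((n:ℂ)+2)) * ((t:ℂ)^(k+1) * Complex.exp (-t) * hcoeff (phi t) (n+1))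
          - (2*(n+1)/((n:ℂ)+2)) * ((t:ℂ)^k * Complex.exp (-t) * hcoeff (phi t) (n+1))
          - (n/((n:ℂ)+2)) * ((t:ℂ)^k * Complex.exp (-t) * hcoeff (phi t) n) := by
      funext t
      have := (phi_rec t).2.2 n
      field_simp
      rw [pow_succ]
      linear_combination (t:ℂ)^k * this
    rw [e]
    have i1 := h1.const_mul (2/((n:ℂ)+2))
    have i3 := h3.const_mul (2*(n+1)/((n:ℂ)+2))
    have i5 := h5.const_mul (n/((n:ℂ)+2))
    refine ⟨(i1.sub i3).sub i5, ?_⟩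
    have i13 : Integrable (fun t : ℝ => (2/((n:ℂ)+2)) * ((t:ℂ)^(k+1) * Complex.exp (-t) * hcoeff (phi t) (n+1))
          - (2*(n+1)/((n:ℂ)+2)) * ((t:ℂ)^k * Complex.exp (-t) * hcoeff (phi t) (n+1)))
        (volume.restrict (Ioi 0)) := i1.sub i3
    rw [integral_sub i13 i5, integral_sub i1 i3, integral_const_mul, integral_const_mul,
      integral_const_mul, h2, h4, h6]
    have hc := congrArg (Nat.cast : ℕ → ℂ) (choose_rec k n)
    push_cast at hc
    rw [Nat.factorial_succ]
    push_cast
    field_simp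
    linear_combination -(k.factorial : ℂ) * 2^k * 4 * hc

theorem orth_zero (a : ℕ → ℂ) (ha : Summable fun n => ‖a n‖^2)
    (h : ∀ t : ℝ, 0 ≤ t → HasSum (fun n => a n * hcoeff (phi t) n) 0) : ∀ n, a n = 0 := by
  have key : ∀ k : ℕ, ∑ n ∈ Finset.range (k+2), a n * (k+1).choose n = 0 := by
    intro k
    set B : ℝ := (∑' n, ‖a n‖^2) + 1 with hB
    have hlim := tendsto_integral_of_dominated_convergence (μ := volume.restrict (Ioi (0:ℝ)))
      (F := fun (N : ℕ) (t : ℝ) => ∑ n ∈ Finset.range N,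
        a n * ((t:ℂ)^k * Complex.exp (-t) * hcoeff (phi t) n))
      (f := fun _ => (0:ℂ)) (fun t => B * (t^k * Real.exp (-(1*t))))
      (fun N => (integrable_finsetSum _ fun n _ =>
        ((moments n k).1.const_mul (a n))).aestronglyMeasurable)
      ((gam_int k one_pos).1.const_mul B)
      (by
        intro N
        filter_upwards [ae_restrict_mem measurableSet_Ioi] with t ht
        have ht0 : (0:ℝ) < t := ht
        have e : ∑ n ∈ Finset.range N, a n * ((t:ℂ)^k * Complex.exp (-t) * hcoeff (phi t) n)
            = ((t:ℂ)^k * Complex.exp (-t)) * ∑ n ∈ Finset.range N, a n * hcoeff (phi t) n := by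
          rw [Finset.mul_sum]
          exact Finset.sum_congr rfl fun n _ => by ring
        have e2 : ‖(t:ℂ)^k * Complex.exp (-t)‖ = t^k * Real.exp (-(1*t)) := by
          simp [Complex.norm_exp, abs_of_pos ht0]
        rw [e, norm_mul, e2, mul_comm]
        gcongr
        have hb := hc_bound (phi_diff t) (fun _ hz => phi_norm_le ht0.le hz) N
        calc ‖∑ n ∈ Finset.range N, a n * hcoeff (phi t) n‖
            ≤ ∑ n ∈ Finset.range N, (‖a n‖^2 + ‖hcoeff (phi t) n‖^2) := by
              refine norm_sum_le_of_le _ fun n _ => ?_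
              rw [norm_mul]
              nlinarith [sq_nonneg (‖a n‖ - ‖hcoeff (phi t) n‖), sq_nonneg (‖a n‖),
                sq_nonneg (‖hcoeff (phi t) n‖)]
          _ ≤ B := by
              rw [Finset.sum_add_distrib, hB]
              exact add_le_add (ha.sum_le_tsum _ fun _ _ => by positivity) hb)
      (by
        filter_upwards [ae_restrict_mem measurableSet_Ioi] with t ht
        have := ((h t (le_of_lt ht)).mul_left ((t:ℂ)^k * Complex.exp (-t))).tendsto_sum_nat
        rw [mul_zero] at this
        refine this.congr fun N => Finset.sum_congr rfl fun n _ => by ring)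
    have hint : ∀ N, ∫ t in Ioi (0:ℝ), ∑ n ∈ Finset.range N,
        a n * ((t:ℂ)^k * Complex.exp (-t) * hcoeff (phi t) n)
        = ∑ n ∈ Finset.range N, a n * (k.factorial / 2^(k+1) * (k+1).choose n) := by
      intro N
      rw [integral_finsetSum _ fun n _ => ((moments n k).1.const_mul (a n))]
      refine Finset.sum_congr rfl fun n _ => ?_
      rw [integral_const_mul, (moments n k).2]
    simp only [hint, integral_zero] at hlim
    have hconst : Filter.Tendsto (fun N => ∑ n ∈ Finset.range N,
        a n * ((k.factorial:ℂ) / 2^(k+1) * (k+1).choose n)) Filter.atTop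
        (nhds (∑ n ∈ Finset.range (k+2), a n * ((k.factorial:ℂ) / 2^(k+1) * (k+1).choose n))) := by
      refine tendsto_const_nhds.congr' ?_
      filter_upwards [Filter.eventually_ge_atTop (k+2)] with N hN
      refine Finset.sum_subset (Finset.range_subset_range.2 hN) fun n _ hn => ?_
      rw [Finset.mem_range, not_lt] at hn
      rw [Nat.choose_eq_zero_of_lt (by omega)]
      simp
    have h0 := tendsto_nhds_unique hconst hlim
    have e : ∑ n ∈ Finset.range (k+2), a n * ((k.factorial:ℂ) / 2^(k+1) * (k+1).choose n)
        = ((k.factorial:ℂ) / 2^(k+1)) * ∑ n ∈ Finset.range (k+2), a n * (k+1).choose n := by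
      rw [Finset.mul_sum]
      exact Finset.sum_congr rfl fun n _ => by ring
    rw [e] at h0
    refine (mul_eq_zero.1 h0).resolve_left ?_
    have := Nat.cast_ne_zero (R := ℂ).2 k.factorial_ne_zero
    exact div_ne_zero this (pow_ne_zero _ two_ne_zero)
  intro n
  induction n using Nat.strong_induction_on with
  | _ n ih =>
  rcases n with _ | k
  · have h0 := h 0 le_rfl
    have e : ∀ n, hcoeff (phi 0) n = if n = 0 then 1 else 0 := by
      intro n
      have : phi 0 = fun _ => (1:ℂ) := by funext z; simp [phi]
      rw [this, hcoeff, iteratedDeriv_const]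
      split_ifs with hn <;> simp [hn]
    simp only [e] at h0
    have h1 := hasSum_single (f := fun n => a n * if n = 0 then (1:ℂ) else 0) 0
      (fun b hb => by simp [hb])
    have := h0.unique h1
    simpa using this.symm
  · have := key k
    rw [Finset.sum_range_succ, Finset.sum_eq_zero] at this
    · simpa using this
    · intro m hm
      rw [Finset.mem_range] at hm
      rw [ih m hm, zero_mul]

theorem memlp_of {f : ℂ → ℂ} (hf : MemH2 f) : Memℓp (hcoeff f) 2 := by
  rw [memℓp_gen_iff (by norm_num)]
  simpa using hf.2

theorem stmt9 :
    (∀ lam : ℝ, 0 ≤ lam → MemH2 (phi lam)) ∧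
    ∀ f, MemH2 f → InClosedSpan phi (Ici (0 : ℝ)) f := by
  refine ⟨fun lam hl => phi_mem hl, fun f hf => ⟨hf, fun ε hε => ?_⟩⟩
  let v : Ici (0:ℝ) → lp (fun _ : ℕ => ℂ) 2 := fun t => ⟨hcoeff (phi t), memlp_of (phi_mem t.2)⟩
  have hdense : (Submodule.span ℂ (range v)).topologicalClosure = ⊤ := by
    rw [Submodule.topologicalClosure_eq_top_iff, Submodule.eq_bot_iff]
    intro g hg
    rw [Submodule.mem_orthogonal'] at hg
    have hz := orth_zero (fun n => starRingEnd ℂ (g n))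
      (by
        have := (memℓp_gen_iff (p := 2) (by norm_num)).1 g.2
        simpa using this)
      (by
        intro t ht
        have h1 := lp.hasSum_inner (𝕜 := ℂ) g (v ⟨t, ht⟩)
        rw [hg _ (Submodule.subset_span ⟨_, rfl⟩)] at h1
        refine h1.congr_fun fun n => ?_
        simp [v, mul_comm])
    ext n
    simpa using hz n
  let F : lp (fun _ : ℕ => ℂ) 2 := ⟨hcoeff f, memlp_of hf⟩
  have hF : F ∈ closure ((Submodule.span ℂ (range v) : Submodule ℂ _) : Set (lp (fun _ : ℕ => ℂ) 2)) := by
    rw [← Submodule.topologicalClosure_coe, hdense]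
    trivial
  obtain ⟨y, hy, hd⟩ := Metric.mem_closure_iff.1 hF (Real.sqrt ε) (Real.sqrt_pos.2 hε)
  obtain ⟨n, c, g, rfl⟩ := Submodule.mem_span_set'.1 hy
  choose lam hlam using fun i => (g i).2
  refine ⟨n, c, fun i => lam i, fun i => (lam i).2, ?_⟩
  have hn : hnormSq (fun z => f z - ∑ i, c i * phi (lam i) z) = ‖F - ∑ i, c i • (g i : lp (fun _ : ℕ => ℂ) 2)‖^2 := by
    have := lp.norm_rpow_eq_tsum (p := 2) (by norm_num) (F - ∑ i, c i • (g i : lp (fun _ : ℕ => ℂ) 2))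
    simp only [ENNReal.toReal_ofNat, Real.rpow_ofNat] at this
    rw [this, hnormSq]
    congr 1
    funext m
    rw [hc_lin hf.1]
    congr 2
    simp only [← hlam]
    simp only [F, v, AddSubgroupClass.coe_sub, lp.coeFn_sum, lp.coeFn_smul]
    have hs : (∑ i, c i • hcoeff (phi (lam i))) m = ∑ i, c i * hcoeff (phi (lam i)) m := by
      simp [Finset.sum_apply]
    exact congrArg (fun w => hcoeff f m - w) hs.symm
  rw [hn, ← dist_eq_norm]
  calc _ < (Real.sqrt ε)^2 := by gcongr
    _ = ε := Real.sq_sqrt hε.le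
end

section
/- For the reproducing kernel k_{−r} of K_{zφ^δ} at v = −r with 0 < r < 1, one has ‖(1+z)k_{−r}‖² = 2/(1+r) + 2r|φ^δ(−r)|²/(1+r), which tends to 1 as r → 1⁻, while ‖k_{−r}‖² → ∞ as r → 1⁻. Consequently the multiplication map f ↦ (1+z)f on K_{zφ^δ} is not bounded below, and (1+z)K_{zφ^δ} is not closed in H^2(𝔻). -/
open Complex MeasureTheory Metric Set

/-- The reproducing kernel of K_{zφ^δ}. -/
noncomputable def repker (δ : ℝ) (v : ℂ) : ℂ → ℂ := fun z =>
  (1 - (starRingEnd ℂ) (v * phi δ v) * (z * phi δ z)) / (1 - (starRingEnd ℂ) v * z)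

open Filter Topology

lemma hcoeff_hasSum {f : ℂ → ℂ} (hf : DifferentiableOn ℂ f (ball 0 1)) {z : ℂ}
    (hz : z ∈ ball (0 : ℂ) 1) : HasSum (fun n => hcoeff f n * z ^ n) (f z) := by
  have := Complex.hasSum_taylorSeries_on_ball hf hz
  convert! this using 2 with n
  simp [hcoeff]
  ring

lemma hcoeff_unique {f : ℂ → ℂ} {b : ℕ → ℂ}
    (h : ∀ z ∈ ball (0 : ℂ) 1, HasSum (fun n => b n * z ^ n) (f z)) (n : ℕ) :
    hcoeff f n = b n := by
  have h1 : HasFPowerSeriesAt f (FormalMultilinearSeries.ofScalars ℂ b) 0 := by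
    rw [hasFPowerSeriesAt_iff']
    filter_upwards [ball_mem_nhds (0 : ℂ) one_pos] with z hz
    convert! h z hz using 2 with n
    simp [FormalMultilinearSeries.coeff_ofScalars]
    ring
  have h2 := h1.analyticAt.hasFPowerSeriesAt
  have h3 := h2.eq_formalMultilinearSeries h1
  have := congrArg (fun p => FormalMultilinearSeries.coeff p n) h3
  simpa [FormalMultilinearSeries.coeff_ofScalars, hcoeff] using this

lemma hcoeff_congr {f g : ℂ → ℂ} (h : Set.EqOn f g (ball (0 : ℂ) 1)) (n : ℕ) :
    hcoeff f n = hcoeff g n := by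
  unfold hcoeff
  congr 1
  apply Filter.EventuallyEq.iteratedDeriv_eq
  filter_upwards [ball_mem_nhds (0 : ℂ) one_pos] with z hz using h hz

lemma hnormSq_congr {f g : ℂ → ℂ} (h : Set.EqOn f g (ball (0 : ℂ) 1)) :
    hnormSq f = hnormSq g := by
  unfold hnormSq
  simp_rw [hcoeff_congr h]

lemma hcoeff_add_mul {f g : ℂ → ℂ} (hf : DifferentiableOn ℂ f (ball 0 1))
    (hg : DifferentiableOn ℂ g (ball 0 1)) (c : ℂ) (n : ℕ) :
    hcoeff (fun z => f z + c * g z) n = hcoeff f n + c * hcoeff g n := by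
  apply hcoeff_unique (b := fun n => hcoeff f n + c * hcoeff g n)
  intro z hz
  convert! (hcoeff_hasSum hf hz).add ((hcoeff_hasSum hg hz).mul_left c) using 2 with n
  ring

/-- Coefficient sequence in ℓ². -/
noncomputable def toL2 (f : ℂ → ℂ) (hf : MemH2 f) : lp (fun _ : ℕ => ℂ) 2 :=
  ⟨hcoeff f, by
    apply memℓp_gen
    simpa using hf.2⟩

lemma toL2_apply (f : ℂ → ℂ) (hf : MemH2 f) (n : ℕ) : toL2 f hf n = hcoeff f n := rfl

lemma hnormSq_eq {f : ℂ → ℂ} (hf : MemH2 f) : hnormSq f = ‖toL2 f hf‖ ^ 2 := by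
  have := lp.norm_rpow_eq_tsum (p := 2) (by norm_num) (toL2 f hf)
  simp only [ENNReal.toReal_ofNat, Real.rpow_ofNat] at this
  rw [this]; rfl

lemma hinner_eq {f g : ℂ → ℂ} (hf : MemH2 f) (hg : MemH2 g) :
    hinner f g = inner ℂ (toL2 f hf) (toL2 g hg) := by
  rw [lp.inner_eq_tsum]
  unfold hinner
  congr 1; ext n
  simp [toL2_apply, mul_comm]

lemma MemH2.add_mul {f g : ℂ → ℂ} (hf : MemH2 f) (hg : MemH2 g) (c : ℂ) :
    MemH2 (fun z => f z + c * g z) := by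
  refine ⟨hf.1.add (hg.1.const_mul c), ?_⟩
  simp_rw [hcoeff_add_mul hf.1 hg.1]
  have := (toL2 f hf + c • toL2 g hg).2.summable (by norm_num)
  simp only [ENNReal.toReal_ofNat, Real.rpow_ofNat] at this
  exact this

lemma toL2_add_mul {f g : ℂ → ℂ} (hf : MemH2 f) (hg : MemH2 g) (c : ℂ) :
    toL2 _ (hf.add_mul hg c) = toL2 f hf + c • toL2 g hg := by
  ext n
  exact hcoeff_add_mul hf.1 hg.1 c n

lemma parseval {f : ℂ → ℂ} (hf : DifferentiableOn ℂ f (ball 0 1)) {R : ℝ} (h0 : 0 ≤ R)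
    (h1 : R < 1) :
    HasSum (fun n => ‖hcoeff f n‖ ^ 2 * R ^ (2 * n))
      (Real.circleAverage (fun z => ‖f z‖ ^ 2) 0 R) := by
  rw [hasSum_iff_tendsto_nat_of_nonneg (fun n => by positivity)]
  have hsum : Summable (fun n => ‖hcoeff f n‖ * R ^ n) := by
    have := (hcoeff_hasSum hf (z := (R : ℂ)) (by simpa [abs_of_nonneg h0] using h1)).summable.norm
    simpa [abs_of_nonneg h0] using this
  let p : ℕ → Polynomial ℂ := fun N =>
    ∑ n ∈ Finset.range N, Polynomial.monomial n (hcoeff f n * (R : ℂ) ^ n)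
  have hcoef : ∀ N n, (p N).coeff n = if n < N then hcoeff f n * (R : ℂ) ^ n else 0 := by
    intro N n
    simp [p, Polynomial.coeff_monomial]
  have hP : ∀ N, ∑ n ∈ Finset.range N, ‖hcoeff f n‖ ^ 2 * R ^ (2 * n) =
      Real.circleAverage (fun z => ‖(p N).eval z‖ ^ 2) 0 1 := by
    intro N
    rw [← Polynomial.sum_sq_norm_coeff_eq_circleAverage]
    rw [Finset.sum_subset (s₁ := (p N).support) (s₂ := Finset.range N)]
    · refine Finset.sum_congr rfl fun n hn => ?_
      rw [hcoef, if_pos (Finset.mem_range.1 hn)]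
      simp only [norm_mul, norm_pow, Complex.norm_real, Real.norm_eq_abs, abs_of_nonneg h0]
      ring
    · intro n hn
      rw [Polynomial.mem_support_iff, hcoef] at hn
      simpa using (ite_ne_right_iff.1 hn).1
    · intro n _ hn
      rw [Polynomial.notMem_support_iff] at hn
      simp [hn]
  simp_rw [hP, Real.circleAverage]
  have heval : ∀ N θ, (p N).eval (circleMap 0 1 θ) =
      ∑ n ∈ Finset.range N, hcoeff f n * (circleMap 0 R θ) ^ n := by
    intro N θ
    simp only [p, Polynomial.eval_finsetSum, Polynomial.eval_monomial]
    refine Finset.sum_congr rfl fun n _ => ?_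
    simp [circleMap, mul_pow]
    ring
  refine Tendsto.const_smul ?_ _
  apply intervalIntegral.tendsto_integral_filter_of_dominated_convergence
    (fun _ => (∑' n, ‖hcoeff f n‖ * R ^ n) ^ 2)
  · refine Eventually.of_forall fun N => ?_
    apply Continuous.aestronglyMeasurable
    fun_prop
  · refine Eventually.of_forall fun N => Eventually.of_forall fun θ _ => ?_
    rw [heval, Real.norm_of_nonneg (by positivity)]
    gcongr
    refine (norm_sum_le _ _).trans ?_
    refine le_trans (le_of_eq ?_) (hsum.sum_le_tsum (Finset.range N) fun _ _ => by positivity)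
    refine Finset.sum_congr rfl fun n _ => ?_
    simp [abs_of_nonneg h0]
  · simp
  · refine Eventually.of_forall fun θ _ => ?_
    simp_rw [heval]
    refine ((hcoeff_hasSum hf ?_).tendsto_sum_nat).norm.pow 2
    simpa [abs_of_nonneg h0] using h1

lemma circInt {f : ℂ → ℂ} (hf : DifferentiableOn ℂ f (ball 0 1)) {R : ℝ} (h0 : 0 ≤ R)
    (h1 : R < 1) : CircleIntegrable (fun z => ‖f z‖ ^ 2) 0 R := by
  apply ContinuousOn.circleIntegrable h0
  refine (hf.continuousOn.norm.pow 2).mono ?_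
  exact sphere_subset_closedBall.trans (closedBall_subset_ball h1)

lemma avg_le {g : ℂ → ℂ} (hg : MemH2 g) {R : ℝ} (h0 : 0 ≤ R) (h1 : R < 1) :
    Real.circleAverage (fun z => ‖g z‖ ^ 2) 0 R ≤ hnormSq g := by
  refine hasSum_le (fun n => ?_) (parseval hg.1 h0 h1) hg.2.hasSum
  exact mul_le_of_le_one_right (by positivity) (pow_le_one₀ h0 h1.le)

lemma bound_of_circle {f : ℂ → ℂ} (hf : DifferentiableOn ℂ f (ball 0 1)) {B : ℝ → ℝ} {b : ℝ}
    (hB : Tendsto B (𝓝[<] 1) (𝓝 b))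
    (h : ∀ R ∈ Set.Ioo (0 : ℝ) 1, Real.circleAverage (fun z => ‖f z‖ ^ 2) 0 R ≤ B R) :
    MemH2 f ∧ hnormSq f ≤ b := by
  have key : ∀ s : Finset ℕ, ∑ n ∈ s, ‖hcoeff f n‖ ^ 2 ≤ b := by
    intro s
    have hc : Continuous fun R : ℝ => ∑ n ∈ s, ‖hcoeff f n‖ ^ 2 * R ^ (2 * n) := by fun_prop
    have ht : Tendsto (fun R : ℝ => ∑ n ∈ s, ‖hcoeff f n‖ ^ 2 * R ^ (2 * n)) (𝓝[<] 1)
        (𝓝 (∑ n ∈ s, ‖hcoeff f n‖ ^ 2)) := by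
      have := (hc.tendsto 1).mono_left (nhdsWithin_le_nhds (s := Set.Iio 1))
      simpa using this
    refine le_of_tendsto_of_tendsto ht hB ?_
    filter_upwards [Ioo_mem_nhdsLT (show (0 : ℝ) < 1 by norm_num)] with R hR
    refine le_trans ?_ (h R hR)
    exact sum_le_hasSum s (fun n _ => by have := hR.1; positivity) (parseval hf hR.1.le hR.2)
  have hs : Summable fun n => ‖hcoeff f n‖ ^ 2 :=
    summable_of_sum_le (fun n => by positivity) key
  exact ⟨⟨hf, hs⟩, hs.tsum_le_of_sum_le key⟩

lemma mul_contract {u : ℂ → ℂ} (hu : DifferentiableOn ℂ u (ball 0 1))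
    (hb : ∀ z ∈ ball (0 : ℂ) 1, ‖u z‖ ≤ 1) {g : ℂ → ℂ} (hg : MemH2 g) :
    MemH2 (fun z => u z * g z) ∧ hnormSq (fun z => u z * g z) ≤ hnormSq g := by
  refine bound_of_circle (hu.mul hg.1) (B := fun _ => hnormSq g) tendsto_const_nhds ?_
  intro R hR
  refine le_trans ?_ (avg_le hg hR.1.le hR.2)
  refine Real.circleAverage_mono (circInt (hu.mul hg.1) hR.1.le hR.2)
    (circInt hg.1 hR.1.le hR.2) ?_
  intro z hz
  have hz' : z ∈ ball (0 : ℂ) 1 := by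
    rw [abs_of_pos hR.1] at hz
    exact closedBall_subset_ball hR.2 (sphere_subset_closedBall hz)
  change ‖u z * g z‖ ^ 2 ≤ ‖g z‖ ^ 2
  rw [norm_mul, mul_pow]
  exact mul_le_of_le_one_left (by positivity) (pow_le_one₀ (norm_nonneg _) (hb z hz'))

lemma mul_isom {u : ℂ → ℂ} (hu : DifferentiableOn ℂ u (ball 0 1))
    (hb : ∀ z ∈ ball (0 : ℂ) 1, ‖u z‖ ≤ 1)
    (hlim : Tendsto (fun R => Real.circleAverage (fun z => ‖u z‖ ^ 2) 0 R) (𝓝[<] 1) (𝓝 1))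
    {h : ℂ → ℂ} (hh : MemH2 h) {C : ℝ} (hC : ∀ z ∈ ball (0 : ℂ) 1, ‖h z‖ ≤ C) :
    hnormSq (fun z => u z * h z) = hnormSq h := by
  obtain ⟨hm, hle⟩ := mul_contract hu hb hh
  refine le_antisymm hle ?_
  refine (bound_of_circle hh.1 (B := fun R => hnormSq (fun z => u z * h z) +
    C ^ 2 * (1 - Real.circleAverage (fun z => ‖u z‖ ^ 2) 0 R)) ?_ ?_).2
  · have := (((tendsto_const_nhds (x := (1 : ℝ))).sub hlim).const_mul (C ^ 2)).const_add
      (hnormSq (fun z => u z * h z))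
    simpa using this
  · intro R hR
    have i1 := circInt hh.1 hR.1.le hR.2
    have i2 := circInt hm.1 hR.1.le hR.2
    have i3 := circInt hu hR.1.le hR.2
    have i4 : CircleIntegrable (fun _ : ℂ => (1 : ℝ)) 0 R := circleIntegrable_const _ _ _
    have i5 : CircleIntegrable (fun z => C ^ 2 * (1 - ‖u z‖ ^ 2)) 0 R := by
      have := (i4.sub i3).const_smul (a := C ^ 2)
      exact this
    have e : Real.circleAverage (fun z => C ^ 2 * (1 - ‖u z‖ ^ 2)) 0 R =
        C ^ 2 * (1 - Real.circleAverage (fun z => ‖u z‖ ^ 2) 0 R) := by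
      have e1 := Real.circleAverage_fun_smul (a := C ^ 2) (f := fun z => 1 - ‖u z‖ ^ 2)
        (c := 0) (R := R)
      have e2 := Real.circleAverage_fun_sub i4 i3
      rw [Real.circleAverage_const] at e2
      rw [← e2]
      exact e1
    have h1 := avg_le hm hR.1.le hR.2
    rw [← e]
    refine le_trans ?_ (add_le_add_left h1 _)
    rw [← Real.circleAverage_fun_add i2 i5]
    refine Real.circleAverage_mono i1 (i2.add i5) ?_
    intro z hz
    have hz' : z ∈ ball (0 : ℂ) 1 := by
      rw [abs_of_pos hR.1] at hz
      exact closedBall_subset_ball hR.2 (sphere_subset_closedBall hz)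
    have a1 := hb z hz'
    have a2 : ‖h z‖ ^ 2 ≤ C ^ 2 := by gcongr; exact hC z hz'
    have a3 : ‖u z‖ ^ 2 ≤ 1 := pow_le_one₀ (norm_nonneg _) a1
    simp only [norm_mul, mul_pow]
    nlinarith

lemma inner_of_contract {E : Type*} [NormedAddCommGroup E] [InnerProductSpace ℂ E]
    {x y x' y' : E} (h : ∀ c : ℂ, ‖x' + c • y'‖ ^ 2 ≤ ‖x + c • y‖ ^ 2)
    (hy : ‖y'‖ ^ 2 = ‖y‖ ^ 2) : inner ℂ x' y' = inner ℂ x y := by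
  set w : ℂ := inner ℂ x' y' - inner ℂ x y with hw
  have key : ∀ c : ℂ, 2 * (c * w).re ≤ ‖x‖ ^ 2 - ‖x'‖ ^ 2 := by
    intro c
    have h1 := h c
    rw [norm_add_sq (𝕜 := ℂ), norm_add_sq (𝕜 := ℂ), norm_smul, norm_smul, mul_pow, mul_pow, hy,
      inner_smul_right, inner_smul_right] at h1
    simp only [RCLike.re_to_complex] at h1
    rw [hw, mul_sub, Complex.sub_re]
    linarith
  by_contra hne
  have hw0 : w ≠ 0 := sub_ne_zero.2 hne
  have h2 := key (((‖x‖ ^ 2 + 1 : ℝ) : ℂ) * w⁻¹)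
  rw [mul_assoc, inv_mul_cancel₀ hw0, mul_one, Complex.ofReal_re] at h2
  nlinarith [sq_nonneg ‖x'‖, sq_nonneg ‖x‖]

lemma hinner_mul_mul {u : ℂ → ℂ} (hu : DifferentiableOn ℂ u (ball 0 1))
    (hb : ∀ z ∈ ball (0 : ℂ) 1, ‖u z‖ ≤ 1)
    (hlim : Tendsto (fun R => Real.circleAverage (fun z => ‖u z‖ ^ 2) 0 R) (𝓝[<] 1) (𝓝 1))
    {g h : ℂ → ℂ} (hg : MemH2 g) (hh : MemH2 h) {C : ℝ}
    (hC : ∀ z ∈ ball (0 : ℂ) 1, ‖h z‖ ≤ C) :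
    hinner (fun z => u z * g z) (fun z => u z * h z) = hinner g h := by
  have mg := (mul_contract hu hb hg).1
  have mh := (mul_contract hu hb hh).1
  rw [hinner_eq mg mh, hinner_eq hg hh]
  apply inner_of_contract
  · intro c
    rw [← toL2_add_mul, ← toL2_add_mul, ← hnormSq_eq, ← hnormSq_eq]
    have := (mul_contract hu hb (hg.add_mul hh c)).2
    convert! this using 3
    ring
  · rw [← hnormSq_eq, ← hnormSq_eq]
    exact mul_isom hu hb hlim hh hC

lemma norm_phi (δ : ℝ) (z : ℂ) :
    ‖phi δ z‖ = Real.exp (-(δ * ((1 - Complex.normSq z) / Complex.normSq (1 + z)))) := by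
  unfold phi
  rw [Complex.norm_exp]
  congr 1
  rw [neg_mul, neg_div, mul_div_assoc, Complex.neg_re, Complex.re_ofReal_mul, Complex.div_re]
  congr 2
  rw [← add_div]
  congr 1
  simp [Complex.normSq_apply]
  ring

lemma one_add_ne {z : ℂ} (hz : z ∈ ball (0 : ℂ) 1) : 1 + z ≠ 0 := by
  intro h
  have : z = -1 := by linear_combination h
  simp [this] at hz

lemma normSq_lt {z : ℂ} (hz : z ∈ ball (0 : ℂ) 1) : Complex.normSq z < 1 := by
  rw [mem_ball_zero_iff] at hz
  rw [Complex.normSq_eq_norm_sq]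
  nlinarith [norm_nonneg z]

lemma norm_phi_le {δ : ℝ} (hδ : 0 < δ) {z : ℂ} (hz : z ∈ ball (0 : ℂ) 1) : ‖phi δ z‖ ≤ 1 := by
  rw [norm_phi]
  apply Real.exp_le_one_iff.2
  have h1 := normSq_lt hz
  have h2 := Complex.normSq_nonneg (1 + z)
  have : 0 ≤ δ * ((1 - Complex.normSq z) / Complex.normSq (1 + z)) := by
    have : 0 ≤ 1 - Complex.normSq z := by linarith
    positivity
  linarith

lemma phi_diffAt (δ : ℝ) {z : ℂ} (hz : 1 + z ≠ 0) : DifferentiableAt ℂ (phi δ) z := by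
  unfold phi
  fun_prop (disch := assumption)

lemma u_diff (δ : ℝ) : DifferentiableOn ℂ (fun z => z * phi δ z) (ball 0 1) := fun z hz =>
  (differentiableAt_id.mul (phi_diffAt δ (one_add_ne hz))).differentiableWithinAt

lemma u_le {δ : ℝ} (hδ : 0 < δ) : ∀ z ∈ ball (0 : ℂ) 1, ‖z * phi δ z‖ ≤ 1 := by
  intro z hz
  rw [norm_mul]
  have := norm_phi_le hδ hz
  rw [mem_ball_zero_iff] at hz
  exact mul_le_one₀ hz.le (norm_nonneg _) this

lemma u_lim {δ : ℝ} (hδ : 0 < δ) :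
    Tendsto (fun R => Real.circleAverage (fun z => ‖z * phi δ z‖ ^ 2) 0 R) (𝓝[<] 1) (𝓝 1) := by
  have hone : (1 : ℝ) = (2 * Real.pi)⁻¹ • ∫ θ in (0 : ℝ)..2 * Real.pi, (1 : ℝ) := by
    have := Real.pi_ne_zero
    simp
    field_simp
  simp only [Real.circleAverage]
  conv => arg 3; rw [hone]
  refine Tendsto.const_smul ?_ _
  have hev : ∀ᶠ R : ℝ in 𝓝[<] 1, R ∈ Set.Ioo (0 : ℝ) 1 :=
    Ioo_mem_nhdsLT (show (0 : ℝ) < 1 by norm_num)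
  apply intervalIntegral.tendsto_integral_filter_of_dominated_convergence (fun _ => (1 : ℝ))
  · filter_upwards [hev] with R hR
    have := (circInt (u_diff δ) hR.1.le hR.2)
    exact (intervalIntegrable_iff.1 this).aestronglyMeasurable
  · filter_upwards [hev] with R hR
    refine Eventually.of_forall fun θ _ => ?_
    rw [Real.norm_of_nonneg (by positivity)]
    apply pow_le_one₀ (norm_nonneg _)
    apply u_le hδ
    simpa [abs_of_pos hR.1] using hR.2
  · simp
  · have hne : ∀ᵐ θ : ℝ, θ ≠ Real.pi := by
      rw [ae_iff]; simp
    filter_upwards [hne] with θ hθ hm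
    rw [Set.uIoc_of_le Real.two_pi_pos.le] at hm
    have hn : 1 + circleMap 0 1 θ ≠ 0 := by
      intro h
      have h1 := congrArg Complex.re h
      simp [circleMap, Complex.exp_ofReal_mul_I_re] at h1
      have h2 : Real.cos (θ - Real.pi) = 1 := by rw [Real.cos_sub_pi]; linarith
      rw [Real.cos_eq_one_iff_of_lt_of_lt (by linarith [hm.1, Real.pi_pos])
        (by linarith [hm.2, Real.pi_pos])] at h2
      exact hθ (by linarith)
    have hc : ContinuousAt (fun z => ‖z * phi δ z‖ ^ 2) (circleMap 0 1 θ) :=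
      ((continuousAt_id.mul (phi_diffAt δ hn).continuousAt).norm).pow 2
    have hval : ‖circleMap 0 1 θ * phi δ (circleMap 0 1 θ)‖ ^ 2 = 1 := by
      rw [norm_mul, norm_phi, Complex.normSq_eq_norm_sq]
      simp
    have hR : Tendsto (fun R : ℝ => circleMap 0 R θ) (𝓝[<] 1) (𝓝 (circleMap 0 1 θ)) := by
      have : Continuous fun R : ℝ => circleMap 0 R θ := by
        unfold circleMap; fun_prop
      exact (this.tendsto 1).mono_left nhdsWithin_le_nhds
    have := hc.tendsto.comp hR
    rw [hval] at this
    exact this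

/-- The Szegő kernel at `-r`. -/
noncomputable def szego (r : ℝ) : ℂ → ℂ := fun z => 1 / (1 + (r : ℂ) * z)

lemma geo {r z : ℂ} (h : ‖r * z‖ < 1) : HasSum (fun n => (-r) ^ n * z ^ n) (1 / (1 + r * z)) := by
  have := hasSum_geometric_of_norm_lt_one (ξ := (-r) * z) (by simpa using h)
  have e : 1 / (1 + r * z) = (1 - -r * z)⁻¹ := by rw [one_div]; ring_nf
  rw [e]
  simpa only [mul_pow] using this

lemma rz_lt {r : ℝ} (h0 : 0 ≤ r) (h1 : r < 1) {z : ℂ} (hz : z ∈ ball (0 : ℂ) 1) :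
    ‖(r : ℂ) * z‖ ≤ r := by
  rw [mem_ball_zero_iff] at hz
  rw [norm_mul, Complex.norm_real, Real.norm_of_nonneg h0]
  exact mul_le_of_le_one_right h0 hz.le

lemma szego_ne {r : ℝ} (h0 : 0 ≤ r) (h1 : r < 1) {z : ℂ} (hz : z ∈ ball (0 : ℂ) 1) :
    1 + (r : ℂ) * z ≠ 0 :=
  one_add_ne (by rw [mem_ball_zero_iff]; exact (rz_lt h0 h1 hz).trans_lt h1)

lemma szego_coeff {r : ℝ} (h0 : 0 ≤ r) (h1 : r < 1) (n : ℕ) :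
    hcoeff (szego r) n = (-(r : ℂ)) ^ n :=
  hcoeff_unique (b := fun n => (-(r : ℂ)) ^ n)
    (fun _ hz => geo ((rz_lt h0 h1 hz).trans_lt h1)) n

lemma szego_mem {r : ℝ} (h0 : 0 ≤ r) (h1 : r < 1) : MemH2 (szego r) := by
  constructor
  · intro z hz
    have := szego_ne h0 h1 hz
    unfold szego
    apply DifferentiableAt.differentiableWithinAt
    fun_prop (disch := assumption)
  · simp_rw [szego_coeff h0 h1]
    have : ∀ n : ℕ, ‖(-(r : ℂ)) ^ n‖ ^ 2 = (r ^ 2) ^ n := by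
      intro n
      rw [norm_pow, norm_neg, Complex.norm_real, Real.norm_of_nonneg h0]
      ring
    simp_rw [this]
    exact summable_geometric_of_lt_one (by positivity) (by nlinarith)

lemma szego_bd {r : ℝ} (h0 : 0 ≤ r) (h1 : r < 1) :
    ∀ z ∈ ball (0 : ℂ) 1, ‖szego r z‖ ≤ 1 / (1 - r) := by
  intro z hz
  unfold szego
  rw [norm_div, norm_one]
  have h2 := rz_lt h0 h1 hz
  have h3 := norm_sub_norm_le (1 : ℂ) (-((r : ℂ) * z))
  rw [norm_one, norm_neg, sub_neg_eq_add] at h3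
  apply one_div_le_one_div_of_le <;> linarith

lemma neg_mem {r : ℝ} (h0 : 0 ≤ r) (h1 : r < 1) : -(r : ℂ) ∈ ball (0 : ℂ) 1 := by
  simpa [abs_of_nonneg h0] using h1

lemma hinner_szego {g : ℂ → ℂ} (hg : MemH2 g) {r : ℝ} (h0 : 0 ≤ r) (h1 : r < 1) :
    hinner g (szego r) = (starRingEnd ℂ) (g (-(r : ℂ))) := by
  have h := hcoeff_hasSum hg.1 (neg_mem h0 h1)
  rw [← h.tsum_eq, Complex.conj_tsum]
  unfold hinner
  congr 1; ext n
  rw [szego_coeff h0 h1]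
  simp

lemma hinner_add_right {g f h : ℂ → ℂ} (hg : MemH2 g) (hf : MemH2 f) (hh : MemH2 h) (c : ℂ) :
    hinner g (fun z => f z + c * h z) = hinner g f + c * hinner g h := by
  rw [hinner_eq hg (hf.add_mul hh c), hinner_eq hg hf, hinner_eq hg hh, toL2_add_mul,
    inner_add_right, inner_smul_right]

lemma hinner_conj {f g : ℂ → ℂ} (hf : MemH2 f) (hg : MemH2 g) :
    (starRingEnd ℂ) (hinner f g) = hinner g f := by
  rw [hinner_eq hf hg, hinner_eq hg hf, inner_conj_symm]

lemma hnormSq_re {f : ℂ → ℂ} (hf : MemH2 f) : hnormSq f = (hinner f f).re := by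
  rw [hnormSq_eq hf, hinner_eq hf hf, inner_self_eq_norm_sq_to_K]
  norm_cast

lemma hnormSq_add {f g : ℂ → ℂ} (hf : MemH2 f) (hg : MemH2 g) (c : ℂ) :
    hnormSq (fun z => f z + c * g z) =
      hnormSq f + 2 * (c * hinner f g).re + ‖c‖ ^ 2 * hnormSq g := by
  rw [hnormSq_eq (hf.add_mul hg c), toL2_add_mul, norm_add_sq (𝕜 := ℂ), hnormSq_eq hf,
    hnormSq_eq hg, hinner_eq hf hg, inner_smul_right, norm_smul, mul_pow]
  rfl

lemma repker_eq (δ r : ℝ) : repker δ (-(r : ℂ)) = fun z => szego r z +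
    ((r : ℂ) * (starRingEnd ℂ) (phi δ (-(r : ℂ)))) * (z * phi δ z * szego r z) := by
  ext z
  simp only [repker, szego, map_mul, map_neg, Complex.conj_ofReal]
  rw [neg_mul, neg_mul, neg_mul, sub_neg_eq_add, sub_neg_eq_add]
  ring

lemma u_szego_mem {δ r : ℝ} (hδ : 0 < δ) (h0 : 0 ≤ r) (h1 : r < 1) :
    MemH2 (fun z => z * phi δ z * szego r z) :=
  (mul_contract (u_diff δ) (u_le hδ) (szego_mem h0 h1)).1

lemma repker_memK {δ r : ℝ} (hδ : 0 < δ) (h0 : 0 ≤ r) (h1 : r < 1) :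
    MemK (fun z => z * phi δ z) (repker δ (-(r : ℂ))) := by
  rw [repker_eq]
  refine ⟨(szego_mem h0 h1).add_mul (u_szego_mem hδ h0 h1) _, fun g hg => ?_⟩
  have hm := (mul_contract (u_diff δ) (u_le hδ) hg).1
  rw [hinner_add_right hm (szego_mem h0 h1) (u_szego_mem hδ h0 h1), hinner_szego hm h0 h1,
    hinner_mul_mul (u_diff δ) (u_le hδ) (u_lim hδ) hg (szego_mem h0 h1) (szego_bd h0 h1),
    hinner_szego hg h0 h1]
  simp

lemma repker_norm {δ r : ℝ} (hδ : 0 < δ) (h0 : 0 ≤ r) (h1 : r < 1) :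
    hnormSq (repker δ (-(r : ℂ))) =
      (1 - r ^ 2 * ‖phi δ (-(r : ℂ))‖ ^ 2) * (1 - r ^ 2)⁻¹ := by
  have hK := repker_memK hδ h0 h1
  have hS := szego_mem h0 h1
  have hu := u_szego_mem hδ h0 h1
  rw [hnormSq_re hK.1]
  have e1 : hinner (repker δ (-(r : ℂ))) (repker δ (-(r : ℂ))) =
      hinner (repker δ (-(r : ℂ))) (szego r) := by
    conv_lhs => arg 2; rw [repker_eq]
    rw [hinner_add_right hK.1 hS hu, ← hinner_conj hu hK.1, hK.2 _ hS]
    simp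
  rw [e1, hinner_szego hK.1 h0 h1, Complex.conj_re]
  have e2 : repker δ (-(r : ℂ)) (-(r : ℂ)) =
      (((1 - r ^ 2 * ‖phi δ (-(r : ℂ))‖ ^ 2) * (1 - r ^ 2)⁻¹ : ℝ) : ℂ) := by
    have := Complex.conj_mul' (phi δ (-(r : ℂ)))
    simp only [repker, map_mul, map_neg, Complex.conj_ofReal]
    push_cast
    rw [← this]
    rw [div_eq_mul_inv]
    congr 1
    · ring
    · congr 1; ring
  rw [e2, Complex.ofReal_re]

/-- `(1+z)/(1+rz)` on the disc. -/
noncomputable def sfun (r : ℝ) : ℂ → ℂ := fun z =>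
  szego 0 z + (((1 - r) / r : ℝ) : ℂ) * (szego 0 z + (-1) * szego r z)

lemma sfun_mem {r : ℝ} (h0 : 0 ≤ r) (h1 : r < 1) : MemH2 (sfun r) :=
  (szego_mem le_rfl one_pos).add_mul
    ((szego_mem le_rfl one_pos).add_mul (szego_mem h0 h1) _) _

lemma sfun_eq {r : ℝ} (h0 : 0 < r) (h1 : r < 1) {z : ℂ} (hz : z ∈ ball (0 : ℂ) 1) :
    sfun r z = (1 + z) / (1 + r * z) := by
  have h2 := szego_ne h0.le h1 hz
  have h3 : (r : ℂ) ≠ 0 := by exact_mod_cast h0.ne'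
  simp only [sfun, szego]
  push_cast
  rw [zero_mul, add_zero, div_one, eq_div_iff h2]
  have h4 : (1 : ℂ) / (1 + r * z) * (1 + r * z) = 1 := by rw [one_div, inv_mul_cancel₀ h2]
  have h5 : ((1 : ℂ) - r) / r * r = 1 - r := div_mul_cancel₀ _ h3
  linear_combination (-((1 - r : ℂ) / r)) * h4 + z * h5

lemma sfun_bd {r : ℝ} (h0 : 0 < r) (h1 : r < 1) :
    ∀ z ∈ ball (0 : ℂ) 1, ‖sfun r z‖ ≤ 2 * (1 / (1 - r)) := by
  intro z hz
  have h := szego_bd h0.le h1 z hz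
  have e : sfun r z = (1 + z) * szego r z := by
    rw [sfun_eq h0 h1 hz, szego]; ring
  rw [e, norm_mul]
  rw [mem_ball_zero_iff] at hz
  have : ‖1 + z‖ ≤ 2 := by
    refine (norm_add_le _ _).trans ?_
    rw [norm_one]; linarith
  gcongr

lemma hinner_sfun {g : ℂ → ℂ} (hg : MemH2 g) {r : ℝ} (h0 : 0 ≤ r) (h1 : r < 1) :
    hinner g (sfun r) = (starRingEnd ℂ) (g 0) +
      (((1 - r) / r : ℝ) : ℂ) *
        ((starRingEnd ℂ) (g 0) - (starRingEnd ℂ) (g (-(r : ℂ)))) := by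
  have hz := szego_mem le_rfl one_pos
  have e0 := hinner_szego hg le_rfl one_pos
  simp only [Complex.ofReal_zero, neg_zero] at e0
  unfold sfun
  rw [hinner_add_right hg hz (hz.add_mul (szego_mem h0 h1) _),
    hinner_add_right hg hz (szego_mem h0 h1), hinner_szego hg h0 h1, e0]
  ring

lemma sfun_zero {r : ℝ} (h0 : 0 < r) (h1 : r < 1) : sfun r 0 = 1 := by
  rw [sfun_eq h0 h1 (by simp)]; simp

lemma sfun_neg {r : ℝ} (h0 : 0 < r) (h1 : r < 1) : sfun r (-(r : ℂ)) = ((1 / (1 + r) : ℝ) : ℂ) := by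
  rw [sfun_eq h0 h1 (neg_mem h0.le h1)]
  have e : (1 : ℂ) + r * -r = (1 - r) * (1 + r) := by ring
  have h2 : (1 : ℂ) - r ≠ 0 := by
    have : (1 : ℝ) - r ≠ 0 := by linarith
    exact_mod_cast this
  have h3 : (1 : ℂ) + r ≠ 0 := by
    have : (1 : ℝ) + r ≠ 0 := by linarith
    exact_mod_cast this
  rw [e]
  push_cast
  field_simp
  ring

/-- The function `(1+z) k_{-r}` on the disc. -/
noncomputable def tfun (δ r : ℝ) : ℂ → ℂ := fun z => sfun r z +
    ((r : ℂ) * (starRingEnd ℂ) (phi δ (-(r : ℂ)))) * (z * phi δ z * sfun r z)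

lemma u_sfun_mem {δ r : ℝ} (hδ : 0 < δ) (h0 : 0 ≤ r) (h1 : r < 1) :
    MemH2 (fun z => z * phi δ z * sfun r z) :=
  (mul_contract (u_diff δ) (u_le hδ) (sfun_mem h0 h1)).1

lemma tfun_mem {δ r : ℝ} (hδ : 0 < δ) (h0 : 0 ≤ r) (h1 : r < 1) : MemH2 (tfun δ r) :=
  (sfun_mem h0 h1).add_mul (u_sfun_mem hδ h0 h1) _

lemma tfun_eq {δ r : ℝ} (h0 : 0 < r) (h1 : r < 1) :
    Set.EqOn (fun z => (1 + z) * repker δ (-(r : ℂ)) z) (tfun δ r) (ball (0 : ℂ) 1) := by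
  intro z hz
  simp only [repker_eq, tfun, sfun_eq h0 h1 hz, szego]
  ring

lemma sfun_norm {r : ℝ} (h0 : 0 < r) (h1 : r < 1) : hnormSq (sfun r) = 2 / (1 + r) := by
  have hm := sfun_mem h0.le h1
  rw [hnormSq_re hm, hinner_sfun hm h0.le h1, sfun_zero h0 h1, sfun_neg h0 h1,
    Complex.conj_ofReal, map_one]
  norm_cast
  have : 1 + r ≠ 0 := by linarith
  field_simp
  ring

lemma tfun_norm {δ r : ℝ} (hδ : 0 < δ) (h0 : 0 < r) (h1 : r < 1) :
    hnormSq (tfun δ r) = 2 / (1 + r) + 2 * r * ‖phi δ (-(r : ℂ))‖ ^ 2 / (1 + r) := by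
  have hm := sfun_mem h0.le h1
  have hum := u_sfun_mem hδ h0.le h1
  unfold tfun
  rw [hnormSq_add hm hum, mul_isom (u_diff δ) (u_le hδ) (u_lim hδ) hm (sfun_bd h0 h1),
    sfun_norm h0 h1, ← hinner_conj hum hm, hinner_sfun hum h0.le h1, sfun_neg h0 h1]
  set A := phi δ (-(r : ℂ)) with hA
  have hr : 1 + r ≠ 0 := by linarith
  have e : (r : ℂ) * (starRingEnd ℂ) A * (starRingEnd ℂ) ((starRingEnd ℂ) (0 * phi δ 0 * sfun r 0) +
      (((1 - r) / r : ℝ) : ℂ) * ((starRingEnd ℂ) (0 * phi δ 0 * sfun r 0) -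
        (starRingEnd ℂ) (-(r : ℂ) * A * ((1 / (1 + r) : ℝ) : ℂ)))) =
      ((r * ((1 - r) / r) * r * (1 / (1 + r)) * ‖A‖ ^ 2 : ℝ) : ℂ) := by
    simp only [zero_mul, map_zero, zero_add, zero_sub, map_mul, map_neg, Complex.conj_ofReal,
      Complex.conj_conj]
    have := Complex.conj_mul' A
    push_cast
    rw [← this]
    ring
  rw [e, Complex.ofReal_re]
  simp only [norm_mul, RCLike.norm_conj, Complex.norm_real, Real.norm_of_nonneg h0.le]
  field_simp
  ring

lemma one_sub_tfun_norm {δ r : ℝ} (hδ : 0 < δ) (h0 : 0 < r) (h1 : r < 1) :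
    hnormSq (fun z => szego 0 z - (1 + z) * repker δ (-(r : ℂ)) z) = hnormSq (tfun δ r) - 1 := by
  have hz := szego_mem le_rfl one_pos
  have ht := tfun_mem hδ h0.le h1
  have e : Set.EqOn (fun z => szego 0 z - (1 + z) * repker δ (-(r : ℂ)) z)
      (fun z => szego 0 z + (-1) * tfun δ r z) (ball (0 : ℂ) 1) := by
    intro z hz
    have := tfun_eq (δ := δ) h0 h1 hz
    simp only at this ⊢
    rw [this]; ring
  have e1 : hinner (szego 0) (szego 0) = 1 := by
    rw [hinner_szego hz le_rfl one_pos]; simp [szego]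
  have e2 : hinner (tfun δ r) (szego 0) = 1 := by
    rw [hinner_szego ht le_rfl one_pos]
    simp [tfun, sfun_zero h0 h1]
  rw [hnormSq_congr e, hnormSq_add hz ht, ← hinner_conj ht hz, e2, hnormSq_re hz, e1]
  simp
  ring

lemma phi_lim {δ : ℝ} (hδ : 0 < δ) :
    Tendsto (fun r : ℝ => ‖phi δ (-(r : ℂ))‖) (𝓝[<] 1) (𝓝 0) := by
  have hc : Tendsto (fun r : ℝ => (1 - r) / δ) (𝓝[<] 1) (𝓝 0) := by
    have : Continuous fun r : ℝ => (1 - r) / δ := by fun_prop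
    have := (this.tendsto 1).mono_left (nhdsWithin_le_nhds (s := Set.Iio 1))
    simpa using this
  refine tendsto_of_tendsto_of_tendsto_of_le_of_le' tendsto_const_nhds hc
    (Eventually.of_forall fun r => norm_nonneg _) ?_
  filter_upwards [Ioo_mem_nhdsLT (show (0 : ℝ) < 1 by norm_num)] with r hr
  have h1 : 0 < 1 - r := by linarith [hr.2]
  rw [norm_phi]
  have e : (1 - Complex.normSq (-(r : ℂ))) / Complex.normSq (1 + -(r : ℂ)) = (1 + r) / (1 - r) := by
    have : (1 : ℂ) + -(r : ℂ) = ((1 - r : ℝ) : ℂ) := by push_cast; ring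
    rw [this, Complex.normSq_neg, Complex.normSq_ofReal, Complex.normSq_ofReal]
    field_simp
    ring
  rw [e, Real.exp_neg]
  have h2 : δ / (1 - r) ≤ Real.exp (δ * ((1 + r) / (1 - r))) := by
    have h3 := Real.add_one_le_exp (δ * ((1 + r) / (1 - r)))
    have h4 : δ / (1 - r) ≤ δ * ((1 + r) / (1 - r)) := by
      rw [← mul_div_assoc]
      gcongr
      nlinarith [hr.1]
    linarith
  have := inv_anti₀ (by positivity) h2
  rwa [inv_div] at this

lemma tfun_lim {δ : ℝ} (hδ : 0 < δ) :
    Tendsto (fun r : ℝ => hnormSq (tfun δ r)) (𝓝[<] 1) (𝓝 1) := by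
  have hid : Tendsto (fun r : ℝ => r) (𝓝[<] 1) (𝓝 1) := nhdsWithin_le_nhds
  have h : Tendsto (fun r : ℝ => 2 / (1 + r) + 2 * r * ‖phi δ (-(r : ℂ))‖ ^ 2 / (1 + r))
      (𝓝[<] 1) (𝓝 (2 / (1 + 1) + 2 * 1 * 0 ^ 2 / (1 + 1))) :=
    (tendsto_const_nhds.div (hid.const_add 1) (by norm_num)).add
      (((hid.const_mul 2).mul ((phi_lim hδ).pow 2)).div (hid.const_add 1) (by norm_num))
  norm_num at h
  refine h.congr' ?_
  filter_upwards [Ioo_mem_nhdsLT (show (0 : ℝ) < 1 by norm_num)] with r hr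
  rw [tfun_norm hδ hr.1 hr.2]

lemma repker_lim {δ : ℝ} (hδ : 0 < δ) :
    Tendsto (fun r : ℝ => hnormSq (repker δ (-(r : ℂ)))) (𝓝[<] 1) atTop := by
  have hid : Tendsto (fun r : ℝ => r) (𝓝[<] 1) (𝓝 1) := nhdsWithin_le_nhds
  have h1 : Tendsto (fun r : ℝ => 1 - r ^ 2 * ‖phi δ (-(r : ℂ))‖ ^ 2) (𝓝[<] 1)
      (𝓝 (1 - 1 ^ 2 * 0 ^ 2)) :=
    ((hid.pow 2).mul ((phi_lim hδ).pow 2)).const_sub 1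
  have hev := Ioo_mem_nhdsLT (show (0 : ℝ) < 1 by norm_num)
  have h2 : Tendsto (fun r : ℝ => (1 - r ^ 2)⁻¹) (𝓝[<] 1) atTop := by
    apply tendsto_inv_nhdsGT_zero.comp
    rw [tendsto_nhdsWithin_iff]
    constructor
    · have := (hid.pow 2).const_sub 1
      simpa using this
    · filter_upwards [hev] with r hr
      simp only [Set.mem_Ioi]
      nlinarith [hr.1, hr.2]
  refine (h1.pos_mul_atTop (by norm_num) h2).congr' ?_
  filter_upwards [hev] with r hr
  rw [repker_norm hδ hr.1.le hr.2]

/-- ‖(1+z)k_{−r}‖² = 2/(1+r) + 2r|φ^δ(−r)|²/(1+r) → 1 as r → 1⁻, while ‖k_{−r}‖² → ∞;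
hence multiplication by (1+z) is not bounded below on K_{zφ^δ}, and (1+z)K_{zφ^δ}
is not closed in H²(𝔻). -/
theorem stmt14 (δ : ℝ) (hδ : 0 < δ) :
    (∀ r ∈ Set.Ioo (0 : ℝ) 1,
      hnormSq (fun z => (1 + z) * repker δ (-(r : ℂ)) z)
        = 2 / (1 + r) + 2 * r * ‖phi δ (-(r : ℂ))‖ ^ 2 / (1 + r)) ∧
    Filter.Tendsto (fun r : ℝ => hnormSq (fun z => (1 + z) * repker δ (-(r : ℂ)) z))
      (nhdsWithin 1 (Set.Iio 1)) (nhds 1) ∧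
    Filter.Tendsto (fun r : ℝ => hnormSq (repker δ (-(r : ℂ))))
      (nhdsWithin 1 (Set.Iio 1)) Filter.atTop ∧
    (¬ ∃ c > (0 : ℝ), ∀ f, MemK (fun z => z * phi δ z) f →
        c * hnormSq f ≤ hnormSq (fun z => (1 + z) * f z)) ∧
    ∃ f, MemH2 f ∧
      (∀ ε > (0 : ℝ), ∃ g, MemK (fun z => z * phi δ z) g ∧
        hnormSq (fun z => f z - (1 + z) * g z) < ε) ∧
      ¬ ∃ g, MemK (fun z => z * phi δ z) g ∧
        Set.EqOn f (fun z => (1 + z) * g z) (ball (0 : ℂ) 1) := by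
  have hev : ∀ᶠ r : ℝ in 𝓝[<] 1, r ∈ Set.Ioo (0 : ℝ) 1 :=
    Ioo_mem_nhdsLT (show (0 : ℝ) < 1 by norm_num)
  have hform : ∀ r ∈ Set.Ioo (0 : ℝ) 1,
      hnormSq (fun z => (1 + z) * repker δ (-(r : ℂ)) z) = hnormSq (tfun δ r) :=
    fun r hr => hnormSq_congr (tfun_eq hr.1 hr.2)
  have hT : Filter.Tendsto (fun r : ℝ => hnormSq (fun z => (1 + z) * repker δ (-(r : ℂ)) z))
      (nhdsWithin 1 (Set.Iio 1)) (nhds 1) := by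
    refine (tfun_lim hδ).congr' ?_
    filter_upwards [hev] with r hr
    rw [hform r hr]
  refine ⟨fun r hr => by rw [hform r hr, tfun_norm hδ hr.1 hr.2], hT, repker_lim hδ, ?_, ?_⟩
  · rintro ⟨c, hc, h⟩
    have h1 := ((repker_lim hδ).const_mul_atTop hc).eventually_gt_atTop 2
    have h2 := hT.eventually_lt_const (show (1 : ℝ) < 2 by norm_num)
    obtain ⟨r, hr, a1, a2⟩ := (hev.and (h1.and h2)).exists
    have := h _ (repker_memK hδ hr.1.le hr.2)
    linarith
  · refine ⟨szego 0, szego_mem le_rfl one_pos, ?_, ?_⟩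
    · intro ε hε
      have h2 := (tfun_lim hδ).eventually_lt_const (show (1 : ℝ) < 1 + ε by linarith)
      obtain ⟨r, hr, a⟩ := (hev.and h2).exists
      refine ⟨_, repker_memK hδ hr.1.le hr.2, ?_⟩
      rw [one_sub_tfun_norm hδ hr.1 hr.2]
      linarith
    · rintro ⟨g, hg, he⟩
      have hcoef : ∀ n, hcoeff g n = (-1) ^ n := by
        intro n
        refine hcoeff_unique (b := fun n => (-1) ^ n) (fun z hz => ?_) n
        have h1 := he hz
        simp only [szego, Complex.ofReal_zero, zero_mul, add_zero, div_one] at h1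
        have h2 : g z = 1 / (1 + 1 * z) := by
          rw [one_mul, eq_div_iff (one_add_ne hz)]; linear_combination -h1
        rw [h2]
        exact geo (by simpa using hz)
      have hs := hg.1.2
      simp [hcoef] at hs
      have ht := hs.tendsto_atTop_zero
      exact one_ne_zero (tendsto_nhds_unique tendsto_const_nhds ht)
end
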